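/- arXiv:math/0102015 — 5 statements merged into one kernel-verified Lean document; each statement's English description precedes it below -/
import Mathlib

section
/- Let W > 0 and define on ℝ²: P₀(u,v) = (1/2)·√W·(1 + u² + v²) and Ω₀(u,v) = −(1/√W)·[ v/(1+u²) + ((1+u²+v²)/(1+u²)^{3/2})·arctan( v/√(1+u²) ) ]. Then Ω₀ is smooth and at every point of ℝ² one has P₀(u,v)² · ∂/∂v ( Ω₀/P₀ )(u,v) = −1. -/
/-- The conformal factor for constant Tanaka–Webster curvature `W > 0`. -/
noncomputable def P₀ (W u v : ℝ) : ℝ := (1 / 2) * Real.sqrt W * (1 + u ^ 2 + v ^ 2)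

/-- The frame component `Ω₀` for constant Tanaka–Webster curvature `W > 0`. -/
noncomputable def Ω₀ (W u v : ℝ) : ℝ :=
  -(1 / Real.sqrt W) *
    (v / (1 + u ^ 2) +
      ((1 + u ^ 2 + v ^ 2) / (1 + u ^ 2) ^ ((3 : ℝ) / 2)) *
        Real.arctan (v / Real.sqrt (1 + u ^ 2)))

theorem contDiff_Ω₀ (W : ℝ) {n : ℕ∞} :
    ContDiff ℝ n (fun p : ℝ × ℝ => Ω₀ W p.1 p.2) := by
  have ha : ∀ p : ℝ × ℝ, 1 + p.1 ^ 2 ≠ 0 := fun p => by positivity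
  have hA : ContDiff ℝ n (fun p : ℝ × ℝ => 1 + p.1 ^ 2) := by fun_prop
  have hB : ContDiff ℝ n (fun p : ℝ × ℝ => 1 + p.1 ^ 2 + p.2 ^ 2) := by fun_prop
  have hs : ContDiff ℝ n (fun p : ℝ × ℝ => Real.sqrt (1 + p.1 ^ 2)) := hA.sqrt ha
  have hr : ContDiff ℝ n (fun p : ℝ × ℝ => (1 + p.1 ^ 2) ^ ((3 : ℝ) / 2)) :=
    hA.rpow_const_of_ne ha
  exact contDiff_const.mul ((contDiff_snd.div hA ha).add
    ((hB.div hr fun p => by positivity).mul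
      (contDiff_snd.div hs fun p => by positivity).arctan))

theorem rpow_three_halves {a : ℝ} (ha : 0 ≤ a) : a ^ ((3 : ℝ) / 2) = Real.sqrt a ^ 3 := by
  rw [Real.sqrt_eq_rpow, ← Real.rpow_natCast, ← Real.rpow_mul ha]
  norm_num

theorem Ω₀_div_P₀ {W : ℝ} (hW : 0 < W) (u v : ℝ) :
    Ω₀ W u v / P₀ W u v =
      -(2 / W) * (v / ((1 + u ^ 2) * (1 + u ^ 2 + v ^ 2)) +
        Real.arctan (v / Real.sqrt (1 + u ^ 2)) / Real.sqrt (1 + u ^ 2) ^ 3) := by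
  have hs : 0 < Real.sqrt W := Real.sqrt_pos.2 hW
  have hb : 0 < Real.sqrt (1 + u ^ 2) := by positivity
  have hc : 0 < 1 + u ^ 2 + v ^ 2 := by positivity
  have ha : 0 < 1 + u ^ 2 := by positivity
  unfold Ω₀ P₀
  rw [rpow_three_halves ha.le]
  have hw : W = Real.sqrt W ^ 2 := (Real.sq_sqrt hW.le).symm
  rw [show 2 / W = 2 / Real.sqrt W ^ 2 by rw [← hw]]
  generalize Real.arctan _ = t
  field_simp

theorem hasDerivAt_Ω₀_div_P₀ {W : ℝ} (hW : 0 < W) (u v : ℝ) :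
    HasDerivAt (fun t => Ω₀ W u t / P₀ W u t) (-(4 / (W * (1 + u ^ 2 + v ^ 2) ^ 2))) v := by
  simp_rw [Ω₀_div_P₀ hW]
  have ha : 0 < 1 + u ^ 2 := by positivity
  generalize 1 + u ^ 2 = a at ha ⊢
  obtain ⟨b, hb, rfl⟩ : ∃ b : ℝ, 0 < b ∧ b ^ 2 = a :=
    ⟨Real.sqrt a, Real.sqrt_pos.2 ha, Real.sq_sqrt ha.le⟩
  rw [Real.sqrt_sq hb.le]
  have hc : b ^ 2 + v ^ 2 ≠ 0 := by positivity
  have hq : HasDerivAt (fun t : ℝ => b ^ 2 * (b ^ 2 + t ^ 2)) (b ^ 2 * (2 * v)) v := by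
    simpa using (((hasDerivAt_id v).pow 2).const_add (b ^ 2)).const_mul (b ^ 2)
  have h := ((((hasDerivAt_id v).div hq (by positivity)).add
    ((((hasDerivAt_id v).div_const b).arctan).div_const (b ^ 3))).const_mul (-(2 / W)))
  refine h.congr_deriv ?_
  have hd : 1 + (v / b) ^ 2 = (b ^ 2 + v ^ 2) / b ^ 2 := by field_simp
  simp only [id]
  rw [hd]
  field_simp
  ring

/-- For `W > 0`, the function `Ω₀` is smooth on `ℝ²` and solves the remaining
field equation `P₀² · ∂/∂v (Ω₀/P₀) = −1`. -/
theorem sasakian_omega_pos (W : ℝ) (hW : 0 < W) :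
    ContDiff ℝ (⊤ : ℕ∞) (fun p : ℝ × ℝ => Ω₀ W p.1 p.2) ∧
    (∀ u v : ℝ,
      (P₀ W u v) ^ 2 * deriv (fun t => Ω₀ W u t / P₀ W u t) v = -1) := by
  refine ⟨contDiff_Ω₀ W, fun u v => ?_⟩
  have hc : 1 + u ^ 2 + v ^ 2 ≠ 0 := by positivity
  rw [(hasDerivAt_Ω₀_div_P₀ hW u v).deriv, P₀, mul_pow, mul_pow, Real.sq_sqrt hW.le]
  field_simp
  norm_num
end

section
/- Let U ⊆ ℝ² be open, and let P₀ : U → ℝ be smooth and positive, τ₀ : U → ℂ and Ω₀ : U → ℂ be smooth, and R : U → ℝ be smooth. Suppose that at every point of U the following three equations hold (with Wirtinger derivatives as in the context): (1) 2P₀·( ∂τ₀/∂z̄ + ∂(conj τ₀)/∂z ) + i·( Ω₀·τ₀ − conj(Ω₀)·conj(τ₀) ) = 2·τ₀·conj(τ₀) − 1 + R/2; (2) 2P₀·( ∂(conj Ω₀)/∂z̄ − ∂Ω₀/∂z ) + 2i·Ω₀·conj(Ω₀) = conj(τ₀)·conj(Ω₀) − τ₀·Ω₀ − 2i; (3) 2·∂P₀/∂z̄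 = conj(τ₀) − i·Ω₀. Then at every point of U one has 8P₀² · ∂²(ln P₀)/∂z∂z̄ = 1 + R/2. -/
open Complex

/-- Wirtinger derivative `∂f/∂z = (1/2)(∂f/∂u − i·∂f/∂v)` for `f : ℝ² → ℂ`, `z = u + iv`. -/
noncomputable def wderivZ (f : ℝ → ℝ → ℂ) (u v : ℝ) : ℂ :=
  (1 / 2) * (deriv (fun t => f t v) u - Complex.I * deriv (fun t => f u t) v)

/-- Wirtinger derivative `∂f/∂z̄ = (1/2)(∂f/∂u + i·∂f/∂v)` for `f : ℝ² → ℂ`, `z = u + iv`. -/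
noncomputable def wderivZbar (f : ℝ → ℝ → ℂ) (u v : ℝ) : ℂ :=
  (1 / 2) * (deriv (fun t => f t v) u + Complex.I * deriv (fun t => f u t) v)

section Wirtinger

variable {f g : ℝ → ℝ → ℂ} {u v : ℝ}

theorem hasDerivAt_slice_fst (hf : DifferentiableAt ℝ (fun p : ℝ × ℝ => f p.1 p.2) (u, v)) :
    HasDerivAt (fun t => f t v) (fderiv ℝ (fun p : ℝ × ℝ => f p.1 p.2) (u, v) (1, 0)) u :=
  hf.hasFDerivAt.comp_hasDerivAt (f := fun t : ℝ => (t, v)) u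
    ((hasDerivAt_id u).prodMk (hasDerivAt_const u v))

theorem hasDerivAt_slice_snd (hf : DifferentiableAt ℝ (fun p : ℝ × ℝ => f p.1 p.2) (u, v)) :
    HasDerivAt (fun t => f u t) (fderiv ℝ (fun p : ℝ × ℝ => f p.1 p.2) (u, v) (0, 1)) v :=
  hf.hasFDerivAt.comp_hasDerivAt (f := fun t : ℝ => (u, t)) v
    ((hasDerivAt_const v u).prodMk (hasDerivAt_id v))

theorem wderivZ_eq_fderiv (hf : DifferentiableAt ℝ (fun p : ℝ × ℝ => f p.1 p.2) (u, v)) :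
    wderivZ f u v = (1 / 2) * (fderiv ℝ (fun p : ℝ × ℝ => f p.1 p.2) (u, v) (1, 0) -
      I * fderiv ℝ (fun p : ℝ × ℝ => f p.1 p.2) (u, v) (0, 1)) := by
  rw [wderivZ, (hasDerivAt_slice_fst hf).deriv, (hasDerivAt_slice_snd hf).deriv]

theorem wderivZbar_eq_fderiv (hf : DifferentiableAt ℝ (fun p : ℝ × ℝ => f p.1 p.2) (u, v)) :
    wderivZbar f u v = (1 / 2) * (fderiv ℝ (fun p : ℝ × ℝ => f p.1 p.2) (u, v) (1, 0) +
      I * fderiv ℝ (fun p : ℝ × ℝ => f p.1 p.2) (u, v) (0, 1)) := by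
  rw [wderivZbar, (hasDerivAt_slice_fst hf).deriv, (hasDerivAt_slice_snd hf).deriv]

theorem eventually_slices {p : ℝ → ℝ → Prop} (h : ∀ᶠ q : ℝ × ℝ in nhds (u, v), p q.1 q.2) :
    (∀ᶠ t in nhds u, p t v) ∧ ∀ᶠ t in nhds v, p u t :=
  ⟨(Continuous.prodMk_left v).continuousAt.eventually h,
    (Continuous.prodMk_right u).continuousAt.eventually h⟩

theorem wderivZ_congr (h : ∀ᶠ q : ℝ × ℝ in nhds (u, v), f q.1 q.2 = g q.1 q.2) :
    wderivZ f u v = wderivZ g u v := by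
  obtain ⟨h₁, h₂⟩ := eventually_slices (p := fun a b => f a b = g a b) h
  rw [wderivZ, wderivZ, Filter.EventuallyEq.deriv_eq h₁, Filter.EventuallyEq.deriv_eq h₂]

theorem wderivZbar_congr (h : ∀ᶠ q : ℝ × ℝ in nhds (u, v), f q.1 q.2 = g q.1 q.2) :
    wderivZbar f u v = wderivZbar g u v := by
  obtain ⟨h₁, h₂⟩ := eventually_slices (p := fun a b => f a b = g a b) h
  rw [wderivZbar, wderivZbar, Filter.EventuallyEq.deriv_eq h₁, Filter.EventuallyEq.deriv_eq h₂]

theorem wderivZ_add_const_mul (c : ℂ)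
    (hf : DifferentiableAt ℝ (fun p : ℝ × ℝ => f p.1 p.2) (u, v))
    (hg : DifferentiableAt ℝ (fun p : ℝ × ℝ => g p.1 p.2) (u, v)) :
    wderivZ (fun a b => f a b + c * g a b) u v = wderivZ f u v + c * wderivZ g u v := by
  simp only [wderivZ]
  rw [((hasDerivAt_slice_fst hf).fun_add ((hasDerivAt_slice_fst hg).const_mul c)).deriv,
    ((hasDerivAt_slice_snd hf).fun_add ((hasDerivAt_slice_snd hg).const_mul c)).deriv,
    (hasDerivAt_slice_fst hf).deriv, (hasDerivAt_slice_fst hg).deriv,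
    (hasDerivAt_slice_snd hf).deriv, (hasDerivAt_slice_snd hg).deriv]
  ring

theorem wderivZbar_add_const_mul (c : ℂ)
    (hf : DifferentiableAt ℝ (fun p : ℝ × ℝ => f p.1 p.2) (u, v))
    (hg : DifferentiableAt ℝ (fun p : ℝ × ℝ => g p.1 p.2) (u, v)) :
    wderivZbar (fun a b => f a b + c * g a b) u v =
      wderivZbar f u v + c * wderivZbar g u v := by
  simp only [wderivZbar]
  rw [((hasDerivAt_slice_fst hf).fun_add ((hasDerivAt_slice_fst hg).const_mul c)).deriv,
    ((hasDerivAt_slice_snd hf).fun_add ((hasDerivAt_slice_snd hg).const_mul c)).deriv,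
    (hasDerivAt_slice_fst hf).deriv, (hasDerivAt_slice_fst hg).deriv,
    (hasDerivAt_slice_snd hf).deriv, (hasDerivAt_slice_snd hg).deriv]
  ring

theorem wderivZ_const_mul (c : ℂ) : wderivZ (fun a b => c * f a b) u v = c * wderivZ f u v := by
  simp only [wderivZ, deriv_const_mul_field]
  ring

theorem wderivZbar_const_mul (c : ℂ) :
    wderivZbar (fun a b => c * f a b) u v = c * wderivZbar f u v := by
  simp only [wderivZbar, deriv_const_mul_field]
  ring

theorem wderivZ_div (hf : DifferentiableAt ℝ (fun p : ℝ × ℝ => f p.1 p.2) (u, v))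
    (hg : DifferentiableAt ℝ (fun p : ℝ × ℝ => g p.1 p.2) (u, v)) (h0 : g u v ≠ 0) :
    wderivZ (fun a b => f a b / g a b) u v =
      (wderivZ f u v * g u v - f u v * wderivZ g u v) / g u v ^ 2 := by
  simp only [wderivZ]
  rw [((hasDerivAt_slice_fst hf).fun_div (hasDerivAt_slice_fst hg) h0).deriv,
    ((hasDerivAt_slice_snd hf).fun_div (hasDerivAt_slice_snd hg) h0).deriv,
    (hasDerivAt_slice_fst hf).deriv, (hasDerivAt_slice_fst hg).deriv,
    (hasDerivAt_slice_snd hf).deriv, (hasDerivAt_slice_snd hg).deriv]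
  ring

theorem wderivZ_ofReal (P : ℝ → ℝ → ℝ)
    (hP : DifferentiableAt ℝ (fun p : ℝ × ℝ => (P p.1 p.2 : ℂ)) (u, v)) :
    wderivZ (fun a b => (P a b : ℂ)) u v =
      (starRingEnd ℂ) (wderivZbar (fun a b => (P a b : ℂ)) u v) := by
  have h₁ := (hasDerivAt_slice_fst (f := fun a b => (P a b : ℂ)) hP).star
  have h₂ := (hasDerivAt_slice_snd (f := fun a b => (P a b : ℂ)) hP).star
  simp only [RCLike.star_def, conj_ofReal] at h₁ h₂
  have e₁ := h₁.deriv
  have e₂ := h₂.deriv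
  rw [← (hasDerivAt_slice_fst (f := fun a b => (P a b : ℂ)) hP).deriv] at e₁
  rw [← (hasDerivAt_slice_snd (f := fun a b => (P a b : ℂ)) hP).deriv] at e₂
  simp only [wderivZ, wderivZbar, map_mul, map_add, map_div₀, map_one, map_ofNat, conj_I,
    ← e₁, ← e₂]
  ring

theorem wderivZbar_log {P : ℝ → ℝ → ℝ}
    (hP : DifferentiableAt ℝ (fun p : ℝ × ℝ => P p.1 p.2) (u, v)) (h0 : P u v ≠ 0) :
    wderivZbar (fun a b => ((Real.log (P a b) : ℝ) : ℂ)) u v =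
      wderivZbar (fun a b => (P a b : ℂ)) u v / P u v := by
  have d₁ : HasDerivAt (fun t => P t v) (deriv (fun t => P t v) u) u :=
    (DifferentiableAt.comp (g := fun p : ℝ × ℝ => P p.1 p.2) (f := fun t : ℝ => (t, v)) u hP
      (by fun_prop)).hasDerivAt
  have d₂ : HasDerivAt (fun t => P u t) (deriv (fun t => P u t) v) v :=
    (DifferentiableAt.comp (g := fun p : ℝ × ℝ => P p.1 p.2) (f := fun t : ℝ => (u, t)) v hP
      (by fun_prop)).hasDerivAt
  rw [wderivZbar, wderivZbar, (d₁.log h0).ofReal_comp.deriv, (d₂.log h0).ofReal_comp.deriv,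
    d₁.ofReal_comp.deriv, d₂.ofReal_comp.deriv]
  push_cast
  ring

theorem eventually_differentiableAt
    (hf : ContDiffAt ℝ 2 (fun p : ℝ × ℝ => f p.1 p.2) (u, v)) :
    ∀ᶠ q : ℝ × ℝ in nhds (u, v),
      DifferentiableAt ℝ (fun p : ℝ × ℝ => f p.1 p.2) (q.1, q.2) :=
  (hf.eventually (by simp)).mono fun _ hq => hq.differentiableAt (by simp)

/-- The Wirtinger derivatives commute on functions of class `C²`. -/
theorem wderivZ_wderivZbar_comm
    (hf : ContDiffAt ℝ 2 (fun p : ℝ × ℝ => f p.1 p.2) (u, v)) :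
    wderivZ (wderivZbar f) u v = wderivZbar (wderivZ f) u v := by
  set F : ℝ × ℝ → ℂ := fun p => f p.1 p.2 with hF
  have hd : DifferentiableAt ℝ (fderiv ℝ F) (u, v) :=
    (hf.fderiv_right (m := 1) (by norm_num)).differentiableAt (by simp)
  have happ (w : ℝ × ℝ) : DifferentiableAt ℝ (fun q : ℝ × ℝ => fderiv ℝ F (q.1, q.2) w) (u, v) :=
    hd.clm_apply (differentiableAt_const w)
  have hsnd (w w' : ℝ × ℝ) : fderiv ℝ (fun q : ℝ × ℝ => fderiv ℝ F (q.1, q.2) w) (u, v) w' =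
      fderiv ℝ (fderiv ℝ F) (u, v) w' w := by
    have := (hd.hasFDerivAt.clm_apply (hasFDerivAt_const w (u, v))).fderiv
    simpa using congrArg (fun L => L w') this
  have hsymm : fderiv ℝ (fderiv ℝ F) (u, v) (1, 0) (0, 1) =
      fderiv ℝ (fderiv ℝ F) (u, v) (0, 1) (1, 0) :=
    (hf.isSymmSndFDerivAt (by simp)).eq _ _
  have hZbar : wderivZ (wderivZbar f) u v = wderivZ (fun a b => (1 / 2) *
      (fderiv ℝ F (a, b) (1, 0) + I * fderiv ℝ F (a, b) (0, 1))) u v :=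
    wderivZ_congr ((eventually_differentiableAt hf).mono fun _ hq => wderivZbar_eq_fderiv hq)
  have hZ : wderivZbar (wderivZ f) u v = wderivZbar (fun a b => (1 / 2) *
      (fderiv ℝ F (a, b) (1, 0) + -I * fderiv ℝ F (a, b) (0, 1))) u v :=
    wderivZbar_congr ((eventually_differentiableAt hf).mono fun _ hq => by
      rw [wderivZ_eq_fderiv hq, neg_mul, sub_eq_add_neg])
  rw [hZbar, hZ, wderivZ_const_mul, wderivZbar_const_mul,
    wderivZ_add_const_mul I (happ _) (happ _), wderivZbar_add_const_mul (-I) (happ _) (happ _),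
    wderivZ_eq_fderiv (happ _), wderivZ_eq_fderiv (happ _),
    wderivZbar_eq_fderiv (happ _), wderivZbar_eq_fderiv (happ _)]
  simp only [hsnd, hsymm]
  ring

end Wirtinger

/-- If `P₀ > 0`, `τ₀`, `Ω₀`, `R` solve the three reduced Sasakian field equations on an
open set `U ⊆ ℝ²`, then `8P₀²·∂²(ln P₀)/∂z∂z̄ = 1 + R/2` on `U`. -/
theorem sasakian_curvature_eq (U : Set (ℝ × ℝ)) (hU : IsOpen U)
    (P₀ : ℝ → ℝ → ℝ) (R : ℝ → ℝ → ℝ) (τ₀ Ω₀ : ℝ → ℝ → ℂ)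
    (hP₀smooth : ContDiffOn ℝ (⊤ : ℕ∞) (fun p : ℝ × ℝ => P₀ p.1 p.2) U)
    (hP₀pos : ∀ u v : ℝ, (u, v) ∈ U → 0 < P₀ u v)
    (hτ₀smooth : ContDiffOn ℝ (⊤ : ℕ∞) (fun p : ℝ × ℝ => τ₀ p.1 p.2) U)
    (hΩ₀smooth : ContDiffOn ℝ (⊤ : ℕ∞) (fun p : ℝ × ℝ => Ω₀ p.1 p.2) U)
    (hRsmooth : ContDiffOn ℝ (⊤ : ℕ∞) (fun p : ℝ × ℝ => R p.1 p.2) U)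
    (heq1 : ∀ u v : ℝ, (u, v) ∈ U →
      2 * (P₀ u v : ℂ) *
          (wderivZbar τ₀ u v + wderivZ (fun a b => (starRingEnd ℂ) (τ₀ a b)) u v) +
        Complex.I * (Ω₀ u v * τ₀ u v -
          (starRingEnd ℂ) (Ω₀ u v) * (starRingEnd ℂ) (τ₀ u v)) =
      2 * τ₀ u v * (starRingEnd ℂ) (τ₀ u v) - 1 + (R u v : ℂ) / 2)
    (heq2 : ∀ u v : ℝ, (u, v) ∈ U →
      2 * (P₀ u v : ℂ) *
          (wderivZbar (fun a b => (starRingEnd ℂ) (Ω₀ a b)) u v - wderivZ Ω₀ u v) +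
        2 * Complex.I * (Ω₀ u v * (starRingEnd ℂ) (Ω₀ u v)) =
      (starRingEnd ℂ) (τ₀ u v) * (starRingEnd ℂ) (Ω₀ u v) - τ₀ u v * Ω₀ u v -
        2 * Complex.I)
    (heq3 : ∀ u v : ℝ, (u, v) ∈ U →
      2 * wderivZbar (fun a b => ((P₀ a b : ℝ) : ℂ)) u v =
        (starRingEnd ℂ) (τ₀ u v) - Complex.I * Ω₀ u v) :
    ∀ u v : ℝ, (u, v) ∈ U →
      8 * (P₀ u v : ℂ) ^ 2 *
          wderivZ (fun a b => wderivZbar (fun s t => ((Real.log (P₀ s t) : ℝ) : ℂ)) a b) u v =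
        1 + (R u v : ℂ) / 2 := by
  intro u v huv
  have hnhds : ∀ᶠ q : ℝ × ℝ in nhds (u, v), (q.1, q.2) ∈ U := hU.mem_nhds huv
  have hPdiff {a b : ℝ} (h : (a, b) ∈ U) :
      DifferentiableAt ℝ (fun p : ℝ × ℝ => P₀ p.1 p.2) (a, b) :=
    (hP₀smooth.contDiffAt (hU.mem_nhds h)).differentiableAt (by simp)
  have hPC {a b : ℝ} (h : (a, b) ∈ U) :
      ContDiffAt ℝ 2 (fun p : ℝ × ℝ => (P₀ p.1 p.2 : ℂ)) (a, b) :=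
    ofRealCLM.contDiff.contDiffAt.comp (a, b)
      ((hP₀smooth.contDiffAt (hU.mem_nhds h)).of_le (WithTop.coe_le_coe.2 (le_top : (2 : ℕ∞) ≤ ⊤)))
  have hPCdiff {a b : ℝ} (h : (a, b) ∈ U) :
      DifferentiableAt ℝ (fun p : ℝ × ℝ => (P₀ p.1 p.2 : ℂ)) (a, b) :=
    (hPC h).differentiableAt (by simp)
  have hτ : DifferentiableAt ℝ (fun p : ℝ × ℝ => τ₀ p.1 p.2) (u, v) :=
    (hτ₀smooth.contDiffAt (hU.mem_nhds huv)).differentiableAt (by simp)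
  have hΩ : DifferentiableAt ℝ (fun p : ℝ × ℝ => Ω₀ p.1 p.2) (u, v) :=
    (hΩ₀smooth.contDiffAt (hU.mem_nhds huv)).differentiableAt (by simp)
  have hτc : DifferentiableAt ℝ (fun p : ℝ × ℝ => (starRingEnd ℂ) (τ₀ p.1 p.2)) (u, v) :=
    hτ.star
  have hΩc : DifferentiableAt ℝ (fun p : ℝ × ℝ => (starRingEnd ℂ) (Ω₀ p.1 p.2)) (u, v) :=
    hΩ.star
  have hP0 {a b : ℝ} (h : (a, b) ∈ U) : (P₀ a b : ℂ) ≠ 0 :=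
    ofReal_ne_zero.2 (hP₀pos a b h).ne'
  have hZbar {a b : ℝ} (h : (a, b) ∈ U) : wderivZbar (fun a b => (P₀ a b : ℂ)) a b =
      (1 / 2) * ((starRingEnd ℂ) (τ₀ a b) + -I * Ω₀ a b) := by
    linear_combination (1 / 2) * heq3 a b h
  have hZ {a b : ℝ} (h : (a, b) ∈ U) : wderivZ (fun a b => (P₀ a b : ℂ)) a b =
      (1 / 2) * (τ₀ a b + I * (starRingEnd ℂ) (Ω₀ a b)) := by
    rw [wderivZ_ofReal P₀ (hPCdiff h), hZbar h]
    simp [map_ofNat]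
  have hlog : wderivZ (fun a b => wderivZbar (fun s t => ((Real.log (P₀ s t) : ℝ) : ℂ)) a b) u v =
      wderivZ (fun a b =>
        ((1 / 2) * ((starRingEnd ℂ) (τ₀ a b) + -I * Ω₀ a b)) / (P₀ a b : ℂ)) u v :=
    wderivZ_congr (hnhds.mono fun q hq => by
      rw [wderivZbar_log (hPdiff hq) (hP₀pos _ _ hq).ne', hZbar hq])
  have hcomm := wderivZ_wderivZbar_comm (f := fun a b => (P₀ a b : ℂ)) (hPC huv)
  rw [wderivZ_congr (g := fun a b => (1 / 2) * ((starRingEnd ℂ) (τ₀ a b) + -I * Ω₀ a b))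
      (hnhds.mono fun q hq => hZbar hq),
    wderivZbar_congr (g := fun a b => (1 / 2) * (τ₀ a b + I * (starRingEnd ℂ) (Ω₀ a b)))
      (hnhds.mono fun q hq => hZ hq), wderivZ_const_mul, wderivZbar_const_mul,
    wderivZ_add_const_mul _ hτc hΩ, wderivZbar_add_const_mul _ hτ hΩc] at hcomm
  have hdiv := wderivZ_div (f := fun a b => (1 / 2) * ((starRingEnd ℂ) (τ₀ a b) + -I * Ω₀ a b))
    (g := fun a b => (P₀ a b : ℂ)) ((hτc.add (hΩ.const_mul (-I))).const_mul (1 / 2))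
    (hPCdiff huv) (hP0 huv)
  rw [wderivZ_const_mul, wderivZ_add_const_mul _ hτc hΩ, hZ huv] at hdiv
  rw [hlog, hdiv, mul_assoc, mul_div_cancel₀ _ (pow_ne_zero 2 (hP0 huv))]
  linear_combination heq1 u v huv + I * heq2 u v huv + 4 * (P₀ u v : ℂ) * hcomm - 2 * I_sq
end

section
/- Let U ⊆ ℝ² be open, let P₀ : U → ℝ be smooth and positive, and let Ω₀ : U → ℝ be smooth with P₀²·∂/∂v(Ω₀/P₀) = −1 at every point of U. Define τ₀ : U → ℂ by τ₀ = 2·∂P₀/∂z − i·Ω₀ and define R : U → ℝ by R = 16·P₀²·∂²(ln P₀)/∂z∂z̄ − 2. Then at every point of U the two reduced Sasakian field equations hold: (1) 2P₀·( ∂τ₀/∂z̄ + ∂(conj τ₀)/∂z ) + i·( Ω₀·τ₀ − Ω₀·conj(τ₀) ) = 2·τ₀·conj(τ₀) − 1 + R/2; (2) 2P₀·( ∂Ω₀/∂z̄ − ∂Ω₀/∂z ) + 2i·Ω₀² = conj(τ₀)·Ω₀ − τ₀·Ω₀ − 2i. (Hence every positive smooth P₀ together with a solution Ω₀ determines a Sasakian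 structure, which is the content of the local moduli theorem.) -/
open Complex

/-- A smooth function on an open subset of the plane has smooth partial derivatives. -/
theorem ContDiffOn.exists_partial_derivs {U : Set (ℝ × ℝ)} (hU : IsOpen U) {F : ℝ × ℝ → ℝ}
    (hF : ContDiffOn ℝ (⊤ : ℕ∞) F U) :
    ∃ Fu Fv : ℝ × ℝ → ℝ, ContDiffOn ℝ (⊤ : ℕ∞) Fu U ∧ ContDiffOn ℝ (⊤ : ℕ∞) Fv U ∧
      ∀ u v : ℝ, (u, v) ∈ U →
        HasDerivAt (fun t => F (t, v)) (Fu (u, v)) u ∧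
          HasDerivAt (fun t => F (u, t)) (Fv (u, v)) v := by
  have hF' : ContDiffOn ℝ (⊤ : ℕ∞) (fderiv ℝ F) U := hF.fderiv_of_isOpen hU (by simp)
  refine ⟨fun p => fderiv ℝ F p (1, 0), fun p => fderiv ℝ F p (0, 1),
    hF'.clm_apply contDiffOn_const, hF'.clm_apply contDiffOn_const, fun u v h => ?_⟩
  have hd : HasFDerivAt F (fderiv ℝ F (u, v)) (u, v) :=
    ((hF.contDiffAt (hU.mem_nhds h)).differentiableAt (by simp)).hasFDerivAt
  exact ⟨hd.comp_hasDerivAt u ((hasDerivAt_id u).prodMk (hasDerivAt_const u v)),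
    hd.comp_hasDerivAt v ((hasDerivAt_const v u).prodMk (hasDerivAt_id v))⟩

/-- The Wirtinger derivatives of `f = x + i·y` in terms of the partial derivatives of `x`
and `y`. -/
theorem wderiv_eq_of_hasDerivAt {U : Set (ℝ × ℝ)} (hU : IsOpen U) {f : ℝ → ℝ → ℂ}
    {x y : ℝ → ℝ → ℝ} (hf : ∀ u v : ℝ, (u, v) ∈ U → f u v = (x u v : ℂ) + (y u v : ℂ) * I)
    {u v : ℝ} (h : (u, v) ∈ U) {xu xv yu yv : ℝ}
    (hxu : HasDerivAt (fun t => x t v) xu u) (hxv : HasDerivAt (fun t => x u t) xv v)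
    (hyu : HasDerivAt (fun t => y t v) yu u) (hyv : HasDerivAt (fun t => y u t) yv v) :
    wderivZ f u v = (1 / 2) * (((xu + yv : ℝ) : ℂ) + ((yu - xv : ℝ) : ℂ) * I) ∧
      wderivZbar f u v = (1 / 2) * (((xu - yv : ℝ) : ℂ) + ((yu + xv : ℝ) : ℂ) * I) := by
  have eu : (fun t => f t v) =ᶠ[nhds u] fun t => (x t v : ℂ) + (y t v : ℂ) * I := by
    have : ∀ᶠ t in nhds u, (t, v) ∈ U :=
      (Continuous.prodMk_left v).continuousAt.eventually_mem (hU.mem_nhds h)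
    filter_upwards [this] with t ht using hf t v ht
  have ev : (fun t => f u t) =ᶠ[nhds v] fun t => (x u t : ℂ) + (y u t : ℂ) * I := by
    have : ∀ᶠ t in nhds v, (u, t) ∈ U :=
      (Continuous.prodMk_right u).continuousAt.eventually_mem (hU.mem_nhds h)
    filter_upwards [this] with t ht using hf u t ht
  have du : deriv (fun t => f t v) u = (xu : ℂ) + (yu : ℂ) * I :=
    ((hxu.ofReal_comp.add (hyu.ofReal_comp.mul_const I)).congr_of_eventuallyEq eu).deriv
  have dv : deriv (fun t => f u t) v = (xv : ℂ) + (yv : ℂ) * I :=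
    ((hxv.ofReal_comp.add (hyv.ofReal_comp.mul_const I)).congr_of_eventuallyEq ev).deriv
  constructor
  · rw [wderivZ, du, dv]
    push_cast
    linear_combination (-(yv : ℂ) / 2) * I_sq
  · rw [wderivZbar, du, dv]
    push_cast
    linear_combination ((yv : ℂ) / 2) * I_sq

/-- Every positive smooth conformal factor `P₀` on an open `U ⊆ ℝ²`, together with a real
solution `Ω₀` of `P₀²·∂/∂v(Ω₀/P₀) = −1`, solves the two reduced Sasakian field equations
with `τ₀ := 2·∂P₀/∂z − i·Ω₀` and `R := 16·P₀²·∂²(ln P₀)/∂z∂z̄ − 2`: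
the content of the local moduli theorem. -/
theorem sasakian_local_moduli (U : Set (ℝ × ℝ)) (hU : IsOpen U)
    (P₀ Ω₀ : ℝ → ℝ → ℝ)
    (hP₀smooth : ContDiffOn ℝ (⊤ : ℕ∞) (fun p : ℝ × ℝ => P₀ p.1 p.2) U)
    (hP₀pos : ∀ u v : ℝ, (u, v) ∈ U → 0 < P₀ u v)
    (hΩ₀smooth : ContDiffOn ℝ (⊤ : ℕ∞) (fun p : ℝ × ℝ => Ω₀ p.1 p.2) U)
    (hΩ₀ : ∀ u v : ℝ, (u, v) ∈ U →
      (P₀ u v) ^ 2 * deriv (fun t => Ω₀ u t / P₀ u t) v = -1)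
    (τ₀ : ℝ → ℝ → ℂ)
    (hτ₀ : ∀ u v : ℝ, (u, v) ∈ U →
      τ₀ u v = 2 * wderivZ (fun a b => ((P₀ a b : ℝ) : ℂ)) u v - Complex.I * (Ω₀ u v : ℂ))
    (R : ℝ → ℝ → ℝ)
    (hR : ∀ u v : ℝ, (u, v) ∈ U →
      (R u v : ℂ) = 16 * (P₀ u v : ℂ) ^ 2 *
          wderivZ (fun a b => wderivZbar (fun s t => ((Real.log (P₀ s t) : ℝ) : ℂ)) a b) u v
        - 2) :
    ∀ u v : ℝ, (u, v) ∈ U →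
      (2 * (P₀ u v : ℂ) *
          (wderivZbar τ₀ u v + wderivZ (fun a b => (starRingEnd ℂ) (τ₀ a b)) u v) +
        Complex.I * ((Ω₀ u v : ℂ) * τ₀ u v - (Ω₀ u v : ℂ) * (starRingEnd ℂ) (τ₀ u v)) =
        2 * τ₀ u v * (starRingEnd ℂ) (τ₀ u v) - 1 + (R u v : ℂ) / 2) ∧
      (2 * (P₀ u v : ℂ) *
          (wderivZbar (fun a b => ((Ω₀ a b : ℝ) : ℂ)) u v -
            wderivZ (fun a b => ((Ω₀ a b : ℝ) : ℂ)) u v) +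
        2 * Complex.I * (Ω₀ u v : ℂ) ^ 2 =
        (starRingEnd ℂ) (τ₀ u v) * (Ω₀ u v : ℂ) - τ₀ u v * (Ω₀ u v : ℂ) -
          2 * Complex.I) := by
  obtain ⟨a, b, ha, hb, hP⟩ := hP₀smooth.exists_partial_derivs hU
  obtain ⟨aa, ab, -, -, hda⟩ := ha.exists_partial_derivs hU
  obtain ⟨ba, bb, -, -, hdb⟩ := hb.exists_partial_derivs hU
  obtain ⟨p, q, -, -, hΩ⟩ := hΩ₀smooth.exists_partial_derivs hU
  dsimp only at hP hΩ
  have hτ : ∀ u v : ℝ, (u, v) ∈ U →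
      τ₀ u v = ((a (u, v) : ℝ) : ℂ) + ((-(b (u, v) + Ω₀ u v) : ℝ) : ℂ) * I := by
    intro u v h
    rw [hτ₀ u v h, (wderiv_eq_of_hasDerivAt (x := P₀) (y := fun _ _ => 0) hU (by simp) h
      (hP u v h).1 (hP u v h).2 (hasDerivAt_const _ _) (hasDerivAt_const _ _)).1]
    push_cast
    ring
  have hτc : ∀ u v : ℝ, (u, v) ∈ U →
      (starRingEnd ℂ) (τ₀ u v) = ((a (u, v) : ℝ) : ℂ) + ((b (u, v) + Ω₀ u v : ℝ) : ℂ) * I := by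
    intro u v h
    rw [hτ u v h]
    simp only [map_add, map_mul, conj_ofReal, conj_I]
    push_cast
    ring
  have hlog : ∀ u v : ℝ, (u, v) ∈ U →
      wderivZbar (fun s t => ((Real.log (P₀ s t) : ℝ) : ℂ)) u v =
        ((a (u, v) / P₀ u v / 2 : ℝ) : ℂ) + ((b (u, v) / P₀ u v / 2 : ℝ) : ℂ) * I := by
    intro u v h
    have hne := (hP₀pos u v h).ne'
    rw [(wderiv_eq_of_hasDerivAt (x := fun s t => Real.log (P₀ s t)) (y := fun _ _ => 0) hU
      (by simp) h ((hP u v h).1.log hne) ((hP u v h).2.log hne) (hasDerivAt_const _ _)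
      (hasDerivAt_const _ _)).2]
    push_cast
    ring
  intro u v h
  have hne := (hP₀pos u v h).ne'
  obtain ⟨hPu, hPv⟩ := hP u v h
  obtain ⟨hau, hav⟩ := hda u v h
  obtain ⟨hbu, hbv⟩ := hdb u v h
  obtain ⟨hΩu, hΩv⟩ := hΩ u v h
  have hode : P₀ u v * q (u, v) = b (u, v) * Ω₀ u v - 1 := by
    have := hΩ₀ u v h
    rw [(hΩv.fun_div hPv hne).deriv] at this
    field_simp at this
    linarith
  have hRv : R u v = 4 * (P₀ u v * (aa (u, v) + bb (u, v)) - a (u, v) ^ 2 - b (u, v) ^ 2) - 2 := by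
    have := hR u v h
    rw [(wderiv_eq_of_hasDerivAt hU hlog h ((hau.fun_div hPu hne).div_const 2)
      ((hav.fun_div hPv hne).div_const 2) ((hbu.fun_div hPu hne).div_const 2)
      ((hbv.fun_div hPv hne).div_const 2)).1] at this
    have hre := congrArg re this
    norm_num [← ofReal_pow, ← ofReal_mul, mul_assoc] at hre
    rw [hre]
    field_simp
    ring
  have hZbar := (wderiv_eq_of_hasDerivAt hU hτ h hau hav (hbu.add hΩu).neg (hbv.add hΩv).neg).2
  have hZ := (wderiv_eq_of_hasDerivAt hU hτc h hau hav (hbu.add hΩu) (hbv.add hΩv)).1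
  obtain ⟨hΩZ, hΩZbar⟩ := wderiv_eq_of_hasDerivAt (f := fun a b => ((Ω₀ a b : ℝ) : ℂ)) (x := Ω₀)
    (y := fun _ _ => 0) hU (by simp) h hΩu hΩv (hasDerivAt_const _ _) (hasDerivAt_const _ _)
  have hodeC : (P₀ u v : ℂ) * q (u, v) = b (u, v) * Ω₀ u v - 1 := by exact_mod_cast hode
  constructor
  · rw [hZbar, hZ, hτc u v h, hτ u v h, hRv]
    push_cast
    linear_combination 2 * hodeC +
      (2 * ((b (u, v) : ℂ) + Ω₀ u v) ^ 2 - 2 * Ω₀ u v * (b (u, v) + Ω₀ u v)) * I_sq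
  · rw [hΩZ, hΩZbar, hτc u v h, hτ u v h]
    push_cast
    linear_combination 2 * I * hodeC
end

section
/- Let U, Ũ ⊆ ℝ² be open, let f, u, v : Ũ → ℝ be smooth with (u,v) mapping Ũ into U, and define Φ : ℝ × Ũ → ℝ × U by Φ(r̃, ũ, ṽ) = (r̃ + f(ũ,ṽ), u(ũ,ṽ), v(ũ,ṽ)). Let P₀ : U → ℝ, P̃₀ : Ũ → ℝ be smooth and positive, and Q : U → ℝ, Q̃ : Ũ → ℝ smooth with ∂Q/∂v = 1/P₀² and ∂Q̃/∂ṽ = 1/P̃₀². Suppose that at every point x ∈ ℝ × Ũ: (i) (DΦ(x))ᵀ · G(Φ(x)) · DΦ(x) = G̃(x), where G, G̃ are the metric matrix fields built from (Q, P₀) and (Q̃, P̃₀) respectively; (ii) the covector (1, Q, 0) at Φ(x) composed with DΦ(x) equals the covector (1, Q̃, 0) at x; and (iii) the Jacobian determinant of (ũ,ṽ) ↦ (u,v) is everywhere positive. Then z = u + iv is a holomorphic function of w = ũ + iṽ (i.e. the Cauchy–Riemann equations ∂u/∂ũ = ∂v/∂ṽ and ∂u/∂ṽ = −∂v/∂ũ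 hold on Ũ), and P̃₀(w)² · ( (∂u/∂ũ)² + (∂v/∂ũ)² ) = P₀(u(w),v(w))² for all w ∈ Ũ. -/
open Matrix

/-- The matrix of the Sasakian metric `ds² = (dr + Q du)² + (1/(2P₀²))(du² + dv²)`
in the coordinate frame `(r,u,v)`. -/
noncomputable def metricG (Q P : ℝ) : Matrix (Fin 3) (Fin 3) ℝ :=
  !![1, Q, 0; Q, Q ^ 2 + 1 / (2 * P ^ 2), 0; 0, 0, 1 / (2 * P ^ 2)]

/-- The Jacobian matrix of the map `(r,u,v) ↦ (Φ₁, Φ₂, Φ₃)(r,u,v)` of `ℝ³`. -/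
noncomputable def jacobian3 (Φ₁ Φ₂ Φ₃ : ℝ → ℝ → ℝ → ℝ) (r u v : ℝ) :
    Matrix (Fin 3) (Fin 3) ℝ :=
  !![deriv (fun t => Φ₁ t u v) r, deriv (fun t => Φ₁ r t v) u, deriv (fun t => Φ₁ r u t) v;
     deriv (fun t => Φ₂ t u v) r, deriv (fun t => Φ₂ r t v) u, deriv (fun t => Φ₂ r u t) v;
     deriv (fun t => Φ₃ t u v) r, deriv (fun t => Φ₃ r t v) u, deriv (fun t => Φ₃ r u t) v]

/-- A linear map of the plane with orthogonal columns of equal length and positive determinant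
satisfies the Cauchy–Riemann equations. -/
theorem cauchyRiemann_of_conformal {A B C D : ℝ} (hnorm : A ^ 2 + C ^ 2 = B ^ 2 + D ^ 2)
    (horth : A * B + C * D = 0) (hdet : 0 < A * D - B * C) : A = D ∧ B = -C := by
  have hsq : (A * D - B * C) ^ 2 = (A ^ 2 + C ^ 2) ^ 2 := by
    linear_combination (-(A ^ 2 + C ^ 2)) * hnorm - (A * B + C * D) * horth
  have hdet_eq : A * D - B * C = A ^ 2 + C ^ 2 :=
    (sq_eq_sq₀ hdet.le (by positivity)).1 hsq
  have hsum : (A - D) ^ 2 + (B + C) ^ 2 = 0 := by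
    linear_combination -2 * hdet_eq - hnorm
  constructor <;> nlinarith [sq_nonneg (A - D), sq_nonneg (B + C)]

/-- If the Jacobian of a map commuting with the Reeb flow pulls back the Sasakian metric and the
contact covector, then its horizontal part is conformal with factor `P ^ 2 / Pt ^ 2`. -/
theorem horizontal_conformal_of_contact_isometry {fa fb A B C D Q P Qt Pt : ℝ}
    (hP : P ≠ 0) (hPt : Pt ≠ 0)
    (hmetric : !![1, fa, fb; 0, A, B; 0, C, D]ᵀ * metricG Q P * !![1, fa, fb; 0, A, B; 0, C, D] =
      metricG Qt Pt)
    (hcontact : Matrix.vecMul ![1, Q, 0] !![1, fa, fb; 0, A, B; 0, C, D] = ![1, Qt, 0]) :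
    Pt ^ 2 * (A ^ 2 + C ^ 2) = P ^ 2 ∧ Pt ^ 2 * (B ^ 2 + D ^ 2) = P ^ 2 ∧ A * B + C * D = 0 := by
  have c1 := congrFun hcontact 1
  have c2 := congrFun hcontact 2
  have m11 := congrFun (congrFun hmetric 1) 1
  have m12 := congrFun (congrFun hmetric 1) 2
  have m22 := congrFun (congrFun hmetric 2) 2
  simp [Matrix.vecMul, dotProduct, Fin.sum_univ_three] at c1 c2
  simp [metricG, Matrix.mul_apply, Fin.sum_univ_three] at m11 m12 m22
  have h11 : (A ^ 2 + C ^ 2) * ((P ^ 2)⁻¹ * 2⁻¹) = (Pt ^ 2)⁻¹ * 2⁻¹ := by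
    linear_combination m11 - (fa + Q * A + Qt) * c1
  have h12 : (A * B + C * D) * ((P ^ 2)⁻¹ * 2⁻¹) = 0 := by
    linear_combination m12 - (fa + Q * A) * c2
  have h22 : (B ^ 2 + D ^ 2) * ((P ^ 2)⁻¹ * 2⁻¹) = (Pt ^ 2)⁻¹ * 2⁻¹ := by
    linear_combination m22 - (fb + Q * B) * c2
  refine ⟨?_, ?_, ?_⟩
  · field_simp at h11
    linear_combination h11
  · field_simp at h22
    linear_combination h22
  · exact (mul_eq_zero.1 h12).resolve_right (by positivity)

/-- If `Φ(r̃,ũ,ṽ) = (r̃ + f(ũ,ṽ), u(ũ,ṽ), v(ũ,ṽ))` is an orientation-preserving contact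
isometry between the Sasakian structures determined by `(P₀, Q)` on `ℝ × U` and
`(P̃₀, Q̃)` on `ℝ × Ũ`, then `z = u + iv` is holomorphic in `w = ũ + iṽ` and
`P̃₀²·|z′|² = P₀² ∘ z`. -/
theorem sasakian_contact_isometry_holomorphic
    (U Ut : Set (ℝ × ℝ)) (hU : IsOpen U) (hUt : IsOpen Ut)
    (f uMap vMap : ℝ → ℝ → ℝ)
    (hfsmooth : ContDiffOn ℝ (⊤ : ℕ∞) (fun p : ℝ × ℝ => f p.1 p.2) Ut)
    (husmooth : ContDiffOn ℝ (⊤ : ℕ∞) (fun p : ℝ × ℝ => uMap p.1 p.2) Ut)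
    (hvsmooth : ContDiffOn ℝ (⊤ : ℕ∞) (fun p : ℝ × ℝ => vMap p.1 p.2) Ut)
    (hmaps : ∀ a b : ℝ, (a, b) ∈ Ut → (uMap a b, vMap a b) ∈ U)
    (P₀ Q : ℝ → ℝ → ℝ) (Pt₀ Qt : ℝ → ℝ → ℝ)
    (hP₀smooth : ContDiffOn ℝ (⊤ : ℕ∞) (fun p : ℝ × ℝ => P₀ p.1 p.2) U)
    (hPt₀smooth : ContDiffOn ℝ (⊤ : ℕ∞) (fun p : ℝ × ℝ => Pt₀ p.1 p.2) Ut)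
    (hQsmooth : ContDiffOn ℝ (⊤ : ℕ∞) (fun p : ℝ × ℝ => Q p.1 p.2) U)
    (hQtsmooth : ContDiffOn ℝ (⊤ : ℕ∞) (fun p : ℝ × ℝ => Qt p.1 p.2) Ut)
    (hP₀pos : ∀ a b : ℝ, (a, b) ∈ U → 0 < P₀ a b)
    (hPt₀pos : ∀ a b : ℝ, (a, b) ∈ Ut → 0 < Pt₀ a b)
    (hQ : ∀ a b : ℝ, (a, b) ∈ U → deriv (fun t => Q a t) b = 1 / P₀ a b ^ 2)
    (hQt : ∀ a b : ℝ, (a, b) ∈ Ut → deriv (fun t => Qt a t) b = 1 / Pt₀ a b ^ 2)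
    (hmetric : ∀ (rt a b : ℝ), (a, b) ∈ Ut →
      (jacobian3 (fun r s t => r + f s t) (fun _ s t => uMap s t)
          (fun _ s t => vMap s t) rt a b)ᵀ *
          metricG (Q (uMap a b) (vMap a b)) (P₀ (uMap a b) (vMap a b)) *
          jacobian3 (fun r s t => r + f s t) (fun _ s t => uMap s t)
            (fun _ s t => vMap s t) rt a b =
        metricG (Qt a b) (Pt₀ a b))
    (hcontact : ∀ (rt a b : ℝ), (a, b) ∈ Ut →
      Matrix.vecMul ![1, Q (uMap a b) (vMap a b), 0]
          (jacobian3 (fun r s t => r + f s t) (fun _ s t => uMap s t)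
            (fun _ s t => vMap s t) rt a b) =
        ![1, Qt a b, 0])
    (horient : ∀ a b : ℝ, (a, b) ∈ Ut →
      0 < deriv (fun t => uMap t b) a * deriv (fun t => vMap a t) b -
          deriv (fun t => uMap a t) b * deriv (fun t => vMap t b) a) :
    ∀ a b : ℝ, (a, b) ∈ Ut →
      (deriv (fun t => uMap t b) a = deriv (fun t => vMap a t) b ∧
       deriv (fun t => uMap a t) b = -deriv (fun t => vMap t b) a) ∧
      Pt₀ a b ^ 2 *
          ((deriv (fun t => uMap t b) a) ^ 2 + (deriv (fun t => vMap t b) a) ^ 2) =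
        P₀ (uMap a b) (vMap a b) ^ 2 := by
  intro a b hab
  have hJ : jacobian3 (fun r s t => r + f s t) (fun _ s t => uMap s t) (fun _ s t => vMap s t)
      0 a b = !![1, deriv (fun t => f t b) a, deriv (fun t => f a t) b;
        0, deriv (fun t => uMap t b) a, deriv (fun t => uMap a t) b;
        0, deriv (fun t => vMap t b) a, deriv (fun t => vMap a t) b] := by
    simp [jacobian3]
  have hm := hmetric 0 a b hab
  have hc := hcontact 0 a b hab
  rw [hJ] at hm hc
  have hPt := (hPt₀pos a b hab).ne'
  obtain ⟨h1, h2, h3⟩ :=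
    horizontal_conformal_of_contact_isometry (hP₀pos _ _ (hmaps a b hab)).ne' hPt hm hc
  have hnorm := mul_left_cancel₀ (pow_ne_zero 2 hPt) (h1.trans h2.symm)
  exact ⟨cauchyRiemann_of_conformal hnorm h3 (horient a b hab), h1⟩
end

section
/- Let W > 0 and, on ℝ², set P₀(u,v) = (1/2)√W(1+u²+v²), Ω₀(u,v) = −(1/√W)[ v/(1+u²) + ((1+u²+v²)/(1+u²)^{3/2})·arctan(v/√(1+u²)) ], and Q = −Ω₀/P₀. Let G be the metric matrix field [[1, Q, 0],[Q, Q² + 1/(2P₀²), 0],[0, 0, 1/(2P₀²)]] in coordinates (r,u,v) on ℝ³. Define Φ on {(ρ,θ,φ) ∈ ℝ³ : 0 < θ < π} by Φ(ρ,θ,φ) = (r(ρ,θ,φ), cos φ · tan(θ/2), sin φ · tan(θ/2)), where r(ρ,θ,φ) = (ρ+φ)/W − (2 cos φ tan(θ/2))/(W·√(1+cos²φ tan²(θ/2))) · arctan( sin φ tan(θ/2) / √(1+cos²φ tan²(θ/2)) ). Then at every point x = (ρ,θ,φ) of the domain: (i) (DΦ(x))ᵀ · G(Φ(x)) · DΦ(x)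 equals the matrix (in the order (ρ,θ,φ)) with entries B_ρρ = 1/W², B_ρθ = 0, B_ρφ = cos θ / W², B_θθ = 1/(2W), B_θφ = 0, B_φφ = sin²θ/(2W) + cos²θ/W² (i.e. the metric (1/(2W))[dθ² + sin²θ dφ² + (2/W)(dρ + cos θ dφ)²], the Berger-sphere form); and (ii) the covector (1, Q, 0) at Φ(x) composed with DΦ(x) equals the covector (1/W, 0, cos θ / W) at x (i.e. the contact form becomes (1/W)(dρ + cos θ dφ)). -/
open Matrix Real

/-- `Q = −Ω₀/P₀`. -/
noncomputable def Qc (W u v : ℝ) : ℝ := -Ω₀ W u v / P₀ W u v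

/-- The first (`r`) component of the Euler-coordinate transformation for `W > 0`. -/
noncomputable def rEuler (W ρ θ φ : ℝ) : ℝ :=
  (ρ + φ) / W -
    (2 * Real.cos φ * Real.tan (θ / 2)) /
        (W * Real.sqrt (1 + Real.cos φ ^ 2 * Real.tan (θ / 2) ^ 2)) *
      Real.arctan (Real.sin φ * Real.tan (θ / 2) /
        Real.sqrt (1 + Real.cos φ ^ 2 * Real.tan (θ / 2) ^ 2))

lemma hasDerivAt_mul_arctan_div_sqrt {W : ℝ} (hW : 0 < W) {u v : ℝ → ℝ} {u' v' x : ℝ}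
    (hu : HasDerivAt u u' x) (hv : HasDerivAt v v' x) :
    HasDerivAt
      (fun t => 2 * u t / (W * √(1 + u t ^ 2)) * Real.arctan (v t / √(1 + u t ^ 2)))
      (Qc W (u x) (v x) * u' - 2 * (v x * u' - u x * v') / (W * (1 + u x ^ 2 + v x ^ 2))) x := by
  have hpos : 0 < 1 + u x ^ 2 := by positivity
  have hS : 0 < √(1 + u x ^ 2) := Real.sqrt_pos.2 hpos
  have hSq : √(1 + u x ^ 2) ^ 2 = 1 + u x ^ 2 := Real.sq_sqrt hpos.le
  have hs : HasDerivAt (fun t => √(1 + u t ^ 2)) (u x * u' / √(1 + u x ^ 2)) x := by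
    refine (((hu.pow 2).const_add 1).sqrt hpos.ne').congr_deriv ?_
    simp only [Pi.pow_apply]
    field_simp
    norm_num
    ring
  have hd := ((hu.const_mul 2).div (hs.const_mul W) (mul_pos hW hS).ne').mul
    (hv.div hs hS.ne').arctan
  refine hd.congr_deriv ?_
  have hrpow : (1 + u x ^ 2) ^ ((3 : ℝ) / 2) = √(1 + u x ^ 2) ^ 3 := by
    rw [Real.sqrt_eq_rpow, ← Real.rpow_natCast (_ ^ _), ← Real.rpow_mul hpos.le]
    norm_num
  have hw : 0 < √W := Real.sqrt_pos.2 hW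
  have hwW : √W ^ 2 = W := Real.sq_sqrt hW.le
  simp only [Qc, Ω₀, P₀, hrpow, Pi.div_apply]
  generalize Real.arctan (v x / √(1 + u x ^ 2)) = A
  generalize √(1 + u x ^ 2) = S at hS hSq ⊢
  generalize √W = w at hw hwW ⊢
  generalize v x = b
  generalize u x = a at hSq ⊢
  subst hwW
  have hR : 0 < S ^ 2 + b ^ 2 := by positivity
  rw [← hSq]
  field_simp
  linear_combination u' * (S * b + A * (S ^ 2 + b ^ 2)) * hSq

/-- The pulled-back metric `α ⊗ α + h (du² + dv²)` in polar coordinates, given the pulled-back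
contact form `(w, 0, w k)`. -/
lemma transpose_mul_metricG_mul (Q P w k c s t τ : ℝ) (hcs : s ^ 2 + c ^ 2 = 1) :
    !![w, -(Q * (c * τ)), w * k + Q * (s * t); 0, c * τ, -s * t; 0, s * τ, c * t]ᵀ *
        metricG Q P *
        !![w, -(Q * (c * τ)), w * k + Q * (s * t); 0, c * τ, -s * t; 0, s * τ, c * t] =
      !![w ^ 2, 0, w ^ 2 * k; 0, τ ^ 2 / (2 * P ^ 2), 0;
         w ^ 2 * k, 0, t ^ 2 / (2 * P ^ 2) + w ^ 2 * k ^ 2] := by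
  ext i j
  fin_cases i <;> fin_cases j <;>
    simp [metricG, Matrix.mul_apply, Fin.sum_univ_three, -mul_eq_zero, -mul_eq_mul_left_iff,
      -mul_eq_mul_right_iff] <;>
    first
    | ring1
    | linear_combination τ ^ 2 / (2 * P ^ 2) * hcs
    | linear_combination t ^ 2 / (2 * P ^ 2) * hcs

lemma vecMul_contactForm (Q w k c s t τ : ℝ) :
    Matrix.vecMul ![1, Q, 0]
        !![w, -(Q * (c * τ)), w * k + Q * (s * t); 0, c * τ, -s * t; 0, s * τ, c * t] =
      ![w, 0, w * k] := by
  ext j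
  fin_cases j <;> simp [Matrix.vecMul, dotProduct, Fin.sum_univ_three]

lemma jacobian3_euler {W : ℝ} (hW : 0 < W) (ρ φ : ℝ) {θ : ℝ} (hc : Real.cos (θ / 2) ≠ 0) :
    jacobian3 (rEuler W) (fun _ a b => Real.cos b * Real.tan (a / 2))
        (fun _ a b => Real.sin b * Real.tan (a / 2)) ρ θ φ =
      !![1 / W,
          -(Qc W (Real.cos φ * Real.tan (θ / 2)) (Real.sin φ * Real.tan (θ / 2)) *
            (Real.cos φ * ((1 + Real.tan (θ / 2) ^ 2) / 2))),
          1 / W * Real.cos θ +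
            Qc W (Real.cos φ * Real.tan (θ / 2)) (Real.sin φ * Real.tan (θ / 2)) *
              (Real.sin φ * Real.tan (θ / 2));
         0, Real.cos φ * ((1 + Real.tan (θ / 2) ^ 2) / 2), -Real.sin φ * Real.tan (θ / 2);
         0, Real.sin φ * ((1 + Real.tan (θ / 2) ^ 2) / 2), Real.cos φ * Real.tan (θ / 2)] := by
  set t := Real.tan (θ / 2)
  set Q := Qc W (Real.cos φ * t) (Real.sin φ * t) with hQ
  set τ := (1 + t ^ 2) / 2
  have hsc := Real.sin_sq_add_cos_sq φ
  have htan : HasDerivAt (fun a : ℝ => Real.tan (a / 2)) τ θ := by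
    refine ((Real.hasDerivAt_tan hc).comp θ ((hasDerivAt_id θ).div_const 2)).congr_deriv ?_
    rw [← Real.inv_one_add_tan_sq hc]
    simp [τ, t, div_eq_mul_inv]
  have hcosθ : Real.cos θ = 1 - 2 * t ^ 2 / (1 + t ^ 2) := by
    have h := Real.tan_sq_div_one_add_tan_sq hc
    rw [mul_div_assoc, h, Real.sin_sq_eq_half_sub, mul_div_cancel₀ θ two_ne_zero]
    ring
  have hR : 1 + (Real.cos φ * t) ^ 2 + (Real.sin φ * t) ^ 2 = 1 + t ^ 2 := by
    linear_combination t ^ 2 * hsc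
  have huθ := htan.const_mul (Real.cos φ)
  have hvθ := htan.const_mul (Real.sin φ)
  have huφ := (Real.hasDerivAt_cos φ).mul_const t
  have hvφ := (Real.hasDerivAt_sin φ).mul_const t
  have hrρ : HasDerivAt (fun x => rEuler W x θ φ) (1 / W) ρ :=
    (((hasDerivAt_id ρ).add_const φ).div_const W).sub_const _
  have hrθ : HasDerivAt (fun x => rEuler W ρ x φ) (-(Q * (Real.cos φ * τ))) θ := by
    have h := (hasDerivAt_mul_arctan_div_sqrt hW huθ hvθ).const_sub ((ρ + φ) / W)
    simp only [mul_pow, ← mul_assoc] at h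
    refine h.congr_deriv ?_
    simp only [Q, t]
    ring_nf
  have hrφ : HasDerivAt (fun x => rEuler W ρ θ x)
      (1 / W * Real.cos θ + Q * (Real.sin φ * t)) φ := by
    have h := (((hasDerivAt_id φ).const_add ρ).div_const W).sub
      (hasDerivAt_mul_arctan_div_sqrt hW huφ hvφ)
    rw [hR] at h
    simp only [mul_pow, ← mul_assoc] at h
    refine h.congr_deriv ?_
    rw [hcosθ]
    have ht : 0 < 1 + t ^ 2 := by positivity
    rw [← hQ]
    field_simp
    linear_combination (-2 * t ^ 2) * hsc
  simp only [jacobian3, hrρ.deriv, hrθ.deriv, hrφ.deriv, huθ.deriv, hvθ.deriv, deriv_const]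
  rw [huφ.deriv, hvφ.deriv]

/-- In Euler coordinates, the `η`-Einstein Sasakian structure with constant
Tanaka–Webster curvature `W > 0` is the Berger-sphere structure
`(1/(2W))[dθ² + sin²θ dφ² + (2/W)(dρ + cos θ dφ)²]` with contact form
`(1/W)(dρ + cos θ dφ)`. -/
theorem sasakian_berger_sphere (W : ℝ) (hW : 0 < W) (ρ θ φ : ℝ)
    (hθ₀ : 0 < θ) (hθπ : θ < Real.pi) :
    (jacobian3 (rEuler W) (fun _ a b => Real.cos b * Real.tan (a / 2))
          (fun _ a b => Real.sin b * Real.tan (a / 2)) ρ θ φ)ᵀ *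
        metricG (Qc W (Real.cos φ * Real.tan (θ / 2)) (Real.sin φ * Real.tan (θ / 2)))
          (P₀ W (Real.cos φ * Real.tan (θ / 2)) (Real.sin φ * Real.tan (θ / 2))) *
        jacobian3 (rEuler W) (fun _ a b => Real.cos b * Real.tan (a / 2))
          (fun _ a b => Real.sin b * Real.tan (a / 2)) ρ θ φ =
      !![1 / W ^ 2, 0, Real.cos θ / W ^ 2;
         0, 1 / (2 * W), 0;
         Real.cos θ / W ^ 2, 0,
           Real.sin θ ^ 2 / (2 * W) + Real.cos θ ^ 2 / W ^ 2] ∧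
    Matrix.vecMul
        ![1, Qc W (Real.cos φ * Real.tan (θ / 2)) (Real.sin φ * Real.tan (θ / 2)), 0]
        (jacobian3 (rEuler W) (fun _ a b => Real.cos b * Real.tan (a / 2))
          (fun _ a b => Real.sin b * Real.tan (a / 2)) ρ θ φ) =
      ![1 / W, 0, Real.cos θ / W] := by
  have hc : Real.cos (θ / 2) ≠ 0 :=
    (Real.cos_pos_of_mem_Ioo ⟨by linarith, by linarith⟩).ne'
  have hsc := Real.sin_sq_add_cos_sq φ
  rw [jacobian3_euler hW ρ φ hc]
  refine ⟨?_, ?_⟩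
  · rw [transpose_mul_metricG_mul _ _ _ _ _ _ _ _ hsc]
    have hP : P₀ W (Real.cos φ * Real.tan (θ / 2)) (Real.sin φ * Real.tan (θ / 2)) ^ 2 =
        W * (1 + Real.tan (θ / 2) ^ 2) ^ 2 / 4 := by
      have hR : 1 + (Real.cos φ * Real.tan (θ / 2)) ^ 2 + (Real.sin φ * Real.tan (θ / 2)) ^ 2 =
          1 + Real.tan (θ / 2) ^ 2 := by
        linear_combination Real.tan (θ / 2) ^ 2 * hsc
      rw [P₀, hR, mul_pow, mul_pow, Real.sq_sqrt hW.le]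
      ring
    have ht : 0 < 1 + Real.tan (θ / 2) ^ 2 := by positivity
    have hθθ : ((1 + Real.tan (θ / 2) ^ 2) / 2) ^ 2 /
        (2 * (W * (1 + Real.tan (θ / 2) ^ 2) ^ 2 / 4)) = 1 / (2 * W) := by
      field_simp
      norm_num
    have hφφ : Real.tan (θ / 2) ^ 2 / (2 * (W * (1 + Real.tan (θ / 2) ^ 2) ^ 2 / 4)) =
        Real.sin θ ^ 2 / (2 * W) := by
      rw [Real.sin_eq_two_mul_tan_half_div_one_add_tan_half_sq θ]
      field_simp
      ring
    rw [hP, hθθ, hφφ, _root_.one_div_pow, one_div_mul_eq_div, one_div_mul_eq_div]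
  · rw [vecMul_contactForm, one_div_mul_eq_div]
end
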